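/- Let ω = exp(2πi/3) and let r₁, r₂, r₃, r₄ ∈ ℂ⁴ be the rows of the Elegant Joint Measurement matrix U₄: r₁ = ((1/2)√(2+√3), 0, 0, −(1/2)√(2−√3)), r₂ = ((1/6)√(6−3√3), 1/√3, 1/√3, (1/6)√(6+3√3)), r₃ = ((1/6)√(6−3√3), ω²/√3, ω/√3, (1/6)√(6+3√3)), r₄ = ((1/6)√(6−3√3), ω/√3, ω²/√3, (1/6)√(6+3√3)). Identify ℂ⁴ with functions Fin 2 × Fin 2 → ℂ via the index map (a,b) ↦ 2a+b, and for each i let ρ_i be the 2×2 reduced matrix ρ_i(a,b) = Σ_{k∈Fin 2} r_i(a,k)·conj(r_i(b,k)). Then for every i, the purity satisfies trace(ρ_i²) = 7/8. -/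

import Mathlib

open scoped ComplexConjugate

noncomputable section

/-- The primitive third root of unity `ω = exp(2πi/3)`. -/
def ω : ℂ := Complex.exp (2 * Real.pi * Complex.I / 3)

/-- The Elegant Joint Measurement matrix `U₄`. -/
def U₄ : Matrix (Fin 4) (Fin 4) ℂ :=
  !![(((1 : ℝ) / 2) * Real.sqrt (2 + Real.sqrt 3) : ℝ), 0, 0,
      (-(((1 : ℝ) / 2) * Real.sqrt (2 - Real.sqrt 3)) : ℝ);
    ((((1 : ℝ) / 6) * Real.sqrt (6 - 3 * Real.sqrt 3) : ℝ) : ℂ),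
      (1 / (Real.sqrt 3 : ℂ)), (1 / (Real.sqrt 3 : ℂ)),
      ((((1 : ℝ) / 6) * Real.sqrt (6 + 3 * Real.sqrt 3) : ℝ) : ℂ);
    ((((1 : ℝ) / 6) * Real.sqrt (6 - 3 * Real.sqrt 3) : ℝ) : ℂ),
      (ω ^ 2 / (Real.sqrt 3 : ℂ)), (ω / (Real.sqrt 3 : ℂ)),
      ((((1 : ℝ) / 6) * Real.sqrt (6 + 3 * Real.sqrt 3) : ℝ) : ℂ);
    ((((1 : ℝ) / 6) * Real.sqrt (6 - 3 * Real.sqrt 3) : ℝ) : ℂ),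
      (ω / (Real.sqrt 3 : ℂ)), (ω ^ 2 / (Real.sqrt 3 : ℂ)),
      ((((1 : ℝ) / 6) * Real.sqrt (6 + 3 * Real.sqrt 3) : ℝ) : ℂ)]

/-- The `i`-th row of `U₄`, viewed as a two-qubit state via `(a,b) ↦ 2a+b`. -/
def ejmState (i : Fin 4) (p : Fin 2 × Fin 2) : ℂ :=
  U₄ i ⟨2 * p.1.val + p.2.val, by omega⟩

/-- The reduced density matrix (partial trace over the second qubit) of the
`i`-th EJM basis state. -/
def ejmReduced (i : Fin 4) : Matrix (Fin 2) (Fin 2) ℂ :=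
  Matrix.of fun a b => ∑ k, ejmState i (a, k) * conj (ejmState i (b, k))

/-- The purity of a reduced two-qubit state in terms of its norm and its determinant. -/
lemma trace_ejmReduced_mul_self (i : Fin 4) :
    Matrix.trace (ejmReduced i * ejmReduced i) =
      (U₄ i 0 * conj (U₄ i 0) + U₄ i 1 * conj (U₄ i 1) + U₄ i 2 * conj (U₄ i 2)
        + U₄ i 3 * conj (U₄ i 3)) ^ 2
      - 2 * ((U₄ i 0 * U₄ i 3 - U₄ i 1 * U₄ i 2)
        * conj (U₄ i 0 * U₄ i 3 - U₄ i 1 * U₄ i 2)) := by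
  have h00 : ejmState i (0, 0) = U₄ i 0 := rfl
  have h01 : ejmState i (0, 1) = U₄ i 1 := rfl
  have h10 : ejmState i (1, 0) = U₄ i 2 := rfl
  have h11 : ejmState i (1, 1) = U₄ i 3 := rfl
  simp only [Matrix.trace_fin_two, Matrix.mul_apply, Fin.sum_univ_two, ejmReduced,
    Matrix.of_apply, h00, h01, h10, h11, map_sub, map_mul]
  ring

lemma ω_pow_three : ω ^ 3 = 1 := by
  rw [ω, ← Complex.exp_nat_mul, ← Complex.exp_two_pi_mul_I]
  congr 1
  push_cast
  ring

lemma ω_mul_conj : ω * conj ω = 1 := by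
  have h : ‖ω‖ = 1 := Complex.norm_eq_one_of_pow_eq_one ω_pow_three (by norm_num)
  rw [Complex.mul_conj, Complex.normSq_eq_norm_sq, h]
  norm_num

/-- The purity of a state `(p, a / √3, b / √3, q)` with real `p`, `q` and phases `a`, `b`
satisfying `a * b = 1`. -/
lemma purity_of_phases {p q s : ℝ} {a b : ℂ} (hs : s ^ 2 = 3) (hnorm : p ^ 2 + q ^ 2 = 1 / 3)
    (hpq : p * q = 1 / 12) (ha : a * conj a = 1) (hb : b * conj b = 1) (hab : a * b = 1) :
    ((p : ℂ) * conj (p : ℂ) + a / s * conj (a / s) + b / s * conj (b / s)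
        + q * conj (q : ℂ)) ^ 2
      - 2 * ((p * q - a / s * (b / s)) * conj (p * q - a / s * (b / s))) = 7 / 8 := by
  have hsC : (s : ℂ) * s = 3 := by rw [← sq]; exact_mod_cast hs
  have hnormC : (p : ℂ) * p + q * q = 1 / 3 := by
    simpa [sq] using congrArg Complex.ofReal hnorm
  have hpqC : (p : ℂ) * q = 1 / 12 := by simpa using congrArg Complex.ofReal hpq
  have hphase (c : ℂ) (hc : c * conj c = 1) : c / s * conj (c / s) = 1 / 3 := by
    rw [map_div₀, Complex.conj_ofReal, div_mul_div_comm, hc, hsC]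
  have hdet : (p : ℂ) * q - a / s * (b / s) = -1 / 4 := by
    rw [div_mul_div_comm, hab, hsC, hpqC]
    norm_num
  have hconj : conj (-1 / 4 : ℂ) = -1 / 4 := by
    simpa using Complex.conj_ofReal (-1 / 4)
  rw [hphase a ha, hphase b hb, hdet, hconj, Complex.conj_ofReal, Complex.conj_ofReal]
  linear_combination ((p : ℂ) * p + q * q + 5 / 3) * hnormC

/-- The purity of a state `(p, 0, 0, -q)` with real `p`, `q`. -/
lemma purity_of_schmidt {p q : ℝ} (hnorm : p ^ 2 + q ^ 2 = 1) (hpq : p * q = 1 / 4) :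
    ((p : ℂ) * conj (p : ℂ) + 0 * conj (0 : ℂ) + 0 * conj (0 : ℂ)
        + ((-q : ℝ) : ℂ) * conj ((-q : ℝ) : ℂ)) ^ 2
      - 2 * ((p * ((-q : ℝ) : ℂ) - 0 * 0) * conj (p * ((-q : ℝ) : ℂ) - 0 * 0)) = 7 / 8 := by
  have hnormC : (p : ℂ) ^ 2 + q ^ 2 = 1 := by simpa using congrArg Complex.ofReal hnorm
  have hpqC : (p : ℂ) * q = 1 / 4 := by simpa using congrArg Complex.ofReal hpq
  simp only [map_sub, map_mul, Complex.conj_ofReal, Complex.ofReal_neg, map_neg, map_zero]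
  linear_combination ((p : ℂ) ^ 2 + q ^ 2 + 1) * hnormC - 2 * (p * q + 1 / 4) * hpqC

/-- Each reduced state of the Elegant Joint Measurement has
purity `trace(ρ_i²) = 7/8`. -/
theorem ejm_purity (i : Fin 4) :
    Matrix.trace (ejmReduced i * ejmReduced i) = (7 / 8 : ℂ) := by
  have h3 : √(3 : ℝ) ^ 2 = 3 := Real.sq_sqrt (by norm_num)
  have hlt : √(3 : ℝ) < 2 := by
    rw [Real.sqrt_lt' (by norm_num)]
    norm_num
  have hpos : 0 ≤ √(3 : ℝ) := Real.sqrt_nonneg 3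
  have hnorm₁ : (1 / 2 * √(2 + √3)) ^ 2 + (1 / 2 * √(2 - √3)) ^ 2 = (1 : ℝ) := by
    rw [mul_pow, mul_pow, Real.sq_sqrt (by linarith), Real.sq_sqrt (by linarith)]
    ring
  have hprod₁ : (1 / 2 * √(2 + √3)) * (1 / 2 * √(2 - √3)) = (1 / 4 : ℝ) := by
    rw [mul_mul_mul_comm, ← Real.sqrt_mul (by linarith),
      show (2 + √3) * (2 - √3) = (1 : ℝ) by linear_combination -h3, Real.sqrt_one]
    norm_num
  have hnorm : (1 / 6 * √(6 - 3 * √3)) ^ 2 + (1 / 6 * √(6 + 3 * √3)) ^ 2 = (1 / 3 : ℝ) := by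
    rw [mul_pow, mul_pow, Real.sq_sqrt (by linarith), Real.sq_sqrt (by linarith)]
    ring
  have hprod : (1 / 6 * √(6 - 3 * √3)) * (1 / 6 * √(6 + 3 * √3)) = (1 / 12 : ℝ) := by
    rw [mul_mul_mul_comm, ← Real.sqrt_mul (by linarith),
      show (6 - 3 * √3) * (6 + 3 * √3) = (3 ^ 2 : ℝ) by linear_combination -9 * h3,
      Real.sqrt_sq (by norm_num)]
    norm_num
  have hω := ω_mul_conj
  have hω2 : ω ^ 2 * conj (ω ^ 2) = 1 := by rw [map_pow, ← mul_pow, hω, one_pow]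
  have hω3 := ω_pow_three
  rw [trace_ejmReduced_mul_self]
  fin_cases i
  · exact purity_of_schmidt hnorm₁ hprod₁
  · exact purity_of_phases h3 hnorm hprod (by simp) (by simp) (one_mul 1)
  · exact purity_of_phases h3 hnorm hprod hω2 hω (by rw [← hω3]; ring)
  · exact purity_of_phases h3 hnorm hprod hω hω2 (by rw [← hω3]; ring)

end
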